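/- arXiv:2210.07018 — 2 statements merged into one kernel-verified Lean document; each statement's English description precedes it below -/
import Mathlib

section
/- For every point x ∈ X, the set {u ≥ 0 : 1/λ(B̄(x,u)) ≤ u} has a minimum element ρ_x; this radius satisfies 0 < ρ_x ≤ 1/λ_x, and moreover 1/λ(B°(x, ρ_x)) ≥ ρ_x ≥ 1/λ(B̄(x, ρ_x)). -/
open MeasureTheory ProbabilityTheory Finset
open scoped Classical ENNReal

noncomputable section

namespace MPMD

variable {X : Type*} {Ω : Type*}

/-- Total arrival rate `Λ = Σ_{x ∈ X} λ_x`. -/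
def totalRate [Fintype X] (lam : X → ℝ) : ℝ := ∑ x, lam x

/-- `λ(B̄(x,u))`, the total rate of the closed ball of radius `u` around `x`. -/
def ballRate [Fintype X] [MetricSpace X] (lam : X → ℝ) (x : X) (u : ℝ) : ℝ :=
  ∑ y ∈ Finset.univ.filter fun y => dist x y ≤ u, lam y

/-- `λ(B°(x,u))`, the total rate of the open ball of radius `u` around `x`. -/
def openBallRate [Fintype X] [MetricSpace X] (lam : X → ℝ) (x : X) (u : ℝ) : ℝ :=
  ∑ y ∈ Finset.univ.filter fun y => dist x y < u, lam y

/-- The radius `ρ_x`: the minimum `u ≥ 0` such that `1/λ(B̄(x,u)) ≤ u`. -/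
def radius [Fintype X] [MetricSpace X] (lam : X → ℝ) (x : X) : ℝ :=
  sInf {u : ℝ | 0 ≤ u ∧ 1 / ballRate lam x u ≤ u}

/-- `E[f(W)]` for `W` exponential with rate `r`, as a lower integral. -/
def expLintegral (f : ℝ → ℝ) (r : ℝ) : ℝ≥0∞ :=
  ∫⁻ t, ENNReal.ofReal (f t) ∂(expMeasure r)

/-- The generalized radius for a delay cost function `f`:
the smallest `u ≥ 0` with `E[f(W̄(x,u))] ≤ u`. -/
def genRadius [Fintype X] [MetricSpace X] (lam : X → ℝ) (f : ℝ → ℝ) (x : X) : ℝ :=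
  sInf {u : ℝ | 0 ≤ u ∧ expLintegral f (ballRate lam x u) ≤ ENNReal.ofReal u}

/-- `K_f := sup_{μ>0} E[f(X_μ)] / E[min{f(X'_μ), E[f(X_μ)]}]` where
`X_μ ~ Exp(μ)` and `X'_μ ~ Exp(2μ)`. -/
def Kf (f : ℝ → ℝ) : ℝ≥0∞ :=
  ⨆ (μ : ℝ) (_ : 0 < μ),
    expLintegral f μ /
      ∫⁻ t, min (ENNReal.ofReal (f t)) (expLintegral f μ) ∂(expMeasure (2 * μ))

/-! ## Request sequences, matchings and costs -/

/-- A perfect matching of the `m` requests: a fixed-point-free involution. -/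
def IsPerfectMatching {m : ℕ} (π : Fin m → Fin m) : Prop :=
  Function.Involutive π ∧ ∀ i, π i ≠ i

/-- Total cost of the perfect matching `π` of the requests with arrival
times `t` and locations `loc` (each pair is counted twice, hence the factor `1/2`). -/
def matchingCost [MetricSpace X] {m : ℕ} (t : Fin m → ℝ) (loc : Fin m → X)
    (π : Fin m → Fin m) : ℝ :=
  (1/2) * ∑ i, (dist (loc i) (loc (π i)) + |t i - t (π i)|)

/-- `OPT(σ)`: the minimum cost of a perfect matching of the requests. -/
def OPT [MetricSpace X] {m : ℕ} (t : Fin m → ℝ) (loc : Fin m → X) : ℝ :=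
  sInf {c : ℝ | ∃ π, IsPerfectMatching π ∧ c = matchingCost t loc π}

/-- Total cost of a perfect matching when delaying for time `u` costs `f u`. -/
def fMatchingCost [MetricSpace X] (f : ℝ → ℝ) {m : ℕ} (t : Fin m → ℝ) (loc : Fin m → X)
    (π : Fin m → Fin m) : ℝ :=
  (1/2) * ∑ i, (dist (loc i) (loc (π i)) + f |t i - t (π i)|)

/-- `OPT_f(σ)` for the `f`-MPMD problem. -/
def OPTf [MetricSpace X] (f : ℝ → ℝ) {m : ℕ} (t : Fin m → ℝ) (loc : Fin m → X) : ℝ :=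
  sInf {c : ℝ | ∃ π, IsPerfectMatching π ∧ c = fMatchingCost f t loc π}

/-- Cost of a partial matching (an involution, whose fixed points are the
cleared requests) with penalty `p` for each cleared request. -/
def penaltyMatchingCost [MetricSpace X] (p : ℝ) {m : ℕ} (t : Fin m → ℝ) (loc : Fin m → X)
    (π : Fin m → Fin m) : ℝ :=
  (1/2) * ∑ i ∈ Finset.univ.filter (fun i => π i ≠ i),
      (dist (loc i) (loc (π i)) + |t i - t (π i)|)
    + p * (Finset.univ.filter fun i => π i = i).card

/-- `OPT_p(σ)` for MPMDfp with penalty `p`. -/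
def OPTp [MetricSpace X] (p : ℝ) {m : ℕ} (t : Fin m → ℝ) (loc : Fin m → X) : ℝ :=
  sInf {c : ℝ | ∃ π, Function.Involutive π ∧ c = penaltyMatchingCost p t loc π}

/-- `c(σ, r_i)`: the minimum total cost of request `i` in the sequence. -/
def minTotalCost [MetricSpace X] {m : ℕ} (t : Fin m → ℝ) (loc : Fin m → X) (i : Fin m) : ℝ :=
  sInf {c : ℝ | ∃ j, j ≠ i ∧ c = dist (loc i) (loc j) + |t i - t j|}

/-- `c_f(σ, r_i)`: the minimum total `f`-cost of request `i` in the sequence. -/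
def minTotalCostF [MetricSpace X] (f : ℝ → ℝ) {m : ℕ} (t : Fin m → ℝ) (loc : Fin m → X)
    (i : Fin m) : ℝ :=
  sInf {c : ℝ | ∃ j, j ≠ i ∧ c = dist (loc i) (loc j) + f |t i - t j|}

/-! ## Online algorithms (outputs characterized by their defining properties) -/

/-- Total (connection + delay) cost of an online run matching request `i` with
request `π i` at service time `s i`. -/
def runCost [MetricSpace X] {m : ℕ} (t : Fin m → ℝ) (loc : Fin m → X)
    (π : Fin m → Fin m) (s : Fin m → ℝ) : ℝ :=
  (1/2) * ∑ i, dist (loc i) (loc (π i)) + ∑ i, (s i - t i)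

/-- Same as `runCost`, for a general delay cost function `f`. -/
def runCostF [MetricSpace X] (f : ℝ → ℝ) {m : ℕ} (t : Fin m → ℝ) (loc : Fin m → X)
    (π : Fin m → Fin m) (s : Fin m → ℝ) : ℝ :=
  (1/2) * ∑ i, dist (loc i) (loc (π i)) + ∑ i, f (s i - t i)

/-- An execution of the Greedy algorithm (with an arbitrary tie-breaking rule):
`π` is the produced perfect matching and `s i` the time at which request `i` is matched.
Every two requests are matched at the first time at which the sum of their waiting
times reaches their distance. -/
def IsGreedyRun [MetricSpace X] {m : ℕ} (t : Fin m → ℝ) (loc : Fin m → X)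
    (π : Fin m → Fin m) (s : Fin m → ℝ) : Prop :=
  Function.Involutive π ∧ (∀ i, π i ≠ i) ∧ (∀ i, s (π i) = s i) ∧
  (∀ i, t i ≤ s i) ∧
  (∀ i, dist (loc i) (loc (π i)) ≤ (s i - t i) + (s i - t (π i))) ∧
  (∀ i j, i ≠ j → ∀ u, max (t i) (t j) ≤ u → u < min (s i) (s j) →
     (u - t i) + (u - t j) < dist (loc i) (loc j))

/-- Arrival order of the requests (ties broken by index). -/
def before {m : ℕ} (t : Fin m → ℝ) (i j : Fin m) : Prop :=
  t i < t j ∨ (t i = t j ∧ i < j)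

/-- The later (in arrival order) of the two requests of the pair of `i`. -/
def pairLater {m : ℕ} (t : Fin m → ℝ) (π : Fin m → Fin m) (i : Fin m) : Fin m :=
  if before t i (π i) then π i else i

/-- Arrival time of the last request. -/
def lastTime {m : ℕ} (t : Fin m → ℝ) : ℝ := ⨆ i, t i

/-- `j` is still pending when request `i` arrives: `j` arrived before `i` and, if the
pair of `j` is matched on arrival (`onA j`), the later request of that pair does not
arrive before `i`. -/
def pendingAt {m : ℕ} (t : Fin m → ℝ) (π : Fin m → Fin m) (onA : Fin m → Prop)
    (i j : Fin m) : Prop :=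
  before t j i ∧ (onA j → ¬ before t (pairLater t π j) i)

/-- An execution of the Radius algorithm with radii `ρ` (arbitrary tie-breaking):
`π` is the produced perfect matching, `onA i` tells whether the pair of `i` was matched
upon the arrival of its later request, and `s i` is the service time of request `i`. -/
def IsRadiusRun [MetricSpace X] {m : ℕ} (ρ : X → ℝ) (t : Fin m → ℝ) (loc : Fin m → X)
    (π : Fin m → Fin m) (onA : Fin m → Prop) (s : Fin m → ℝ) : Prop :=
  Function.Involutive π ∧ (∀ i, π i ≠ i) ∧ (∀ i, onA (π i) ↔ onA i) ∧
  (∀ i, onA i → s i = max (t i) (t (π i))) ∧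
  (∀ i, ¬ onA i → s i = lastTime t) ∧
  -- if `i` is matched with a pending request `π i` upon its arrival, then either the
  -- first matching criterion holds, or the second one holds and the first one fails
  -- for every pending request
  (∀ i, onA i → before t (π i) i →
      (dist (loc i) (loc (π i)) ≤ ρ (loc (π i)) ∨
       (dist (loc i) (loc (π i)) ≤ ρ (loc (π i)) + ρ (loc i) ∧
        ∀ j, pendingAt t π onA i j → ¬ dist (loc i) (loc j) ≤ ρ (loc j)))) ∧
  -- if `i` becomes pending at its arrival, then no pending request was compatible
  (∀ i, ¬ (onA i ∧ before t (π i) i) →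
      ∀ j, pendingAt t π onA i j → ¬ dist (loc i) (loc j) ≤ ρ (loc j) + ρ (loc i))

/-- `j` is pending when `i` arrives, for MPMDfp runs (cleared requests,
i.e. fixed points of `π`, are never pending). -/
def pendingAtP {m : ℕ} (t : Fin m → ℝ) (π : Fin m → Fin m) (onA : Fin m → Prop)
    (i j : Fin m) : Prop :=
  before t j i ∧ π j ≠ j ∧ (onA j → ¬ before t (pairLater t π j) i)

/-- An execution of the algorithm `ALG` for MPMDfp with radii `ρ` and penalty `p`:
`π` is an involution whose fixed points are the cleared requests. -/
def IsALGRun [MetricSpace X] {m : ℕ} (ρ : X → ℝ) (p : ℝ) (t : Fin m → ℝ) (loc : Fin m → X)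
    (π : Fin m → Fin m) (onA : Fin m → Prop) (s : Fin m → ℝ) : Prop :=
  Function.Involutive π ∧ (∀ i, onA (π i) ↔ onA i) ∧
  (∀ i, π i ≠ i → onA i → s i = max (t i) (t (π i))) ∧
  (∀ i, π i ≠ i → ¬ onA i → s i = lastTime t) ∧
  -- a request arriving at a point of `X⁽²⁾` (i.e. `ρ ≥ p`) is matched, at its arrival,
  -- with a pending request at a point `y ∈ X⁽¹⁾` whose ball contains it, if any
  (∀ i, p ≤ ρ (loc i) → π i ≠ i →
      onA i ∧ before t (π i) i ∧ pendingAtP t π onA i (π i) ∧ ρ (loc (π i)) < p ∧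
      dist (loc i) (loc (π i)) ≤ ρ (loc (π i))) ∧
  -- ... and is cleared otherwise
  (∀ i, p ≤ ρ (loc i) → π i = i →
      ∀ j, pendingAtP t π onA i j → ρ (loc j) < p → ¬ dist (loc i) (loc j) ≤ ρ (loc j)) ∧
  -- a request arriving at a point of `X⁽¹⁾` (i.e. `ρ < p`) is processed by the
  -- Radius algorithm
  (∀ i, ρ (loc i) < p → π i ≠ i → onA i → before t (π i) i →
      pendingAtP t π onA i (π i) ∧
      (dist (loc i) (loc (π i)) ≤ ρ (loc (π i)) ∨
       (dist (loc i) (loc (π i)) ≤ ρ (loc (π i)) + ρ (loc i) ∧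
        ∀ j, pendingAtP t π onA i j → ¬ dist (loc i) (loc j) ≤ ρ (loc j)))) ∧
  (∀ i, ρ (loc i) < p → ¬ (π i ≠ i ∧ onA i ∧ before t (π i) i) →
      ∀ j, pendingAtP t π onA i j → ¬ dist (loc i) (loc j) ≤ ρ (loc j) + ρ (loc i)) ∧
  -- only the very last request may be cleared among requests of `X⁽¹⁾`
  (∀ i, ρ (loc i) < p → π i = i → ∀ j, j ≠ i → before t j i)

/-- Total cost (connection + delay + penalties) of an MPMDfp run. -/
def runCostP [MetricSpace X] (p : ℝ) {m : ℕ} (t : Fin m → ℝ) (loc : Fin m → X)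
    (π : Fin m → Fin m) (s : Fin m → ℝ) : ℝ :=
  (1/2) * ∑ i ∈ Finset.univ.filter (fun i => π i ≠ i), dist (loc i) (loc (π i))
    + ∑ i ∈ Finset.univ.filter (fun i => π i ≠ i), (s i - t i)
    + p * (Finset.univ.filter fun i => π i = i).card

/-! ## The Poisson arrival model -/

/-- Arrival time of the `i`-th request (`0`-indexed): the sum of the first `i`
inter-arrival times. -/
def arrivalTime (W : ℕ → Ω → ℝ) (i : ℕ) (ω : Ω) : ℝ := ∑ j ∈ Finset.range i, W j ω

/-- The combined family of inter-arrival times and locations, used to state that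
they are all mutually independent. -/
def pairFam {X : Type} {Ω : Type*} (W : ℕ → Ω → ℝ) (L : ℕ → Ω → X) :
    (k : ℕ ⊕ ℕ) → Ω → Sum.elim (fun _ : ℕ => ℝ) (fun _ : ℕ => X) k
  | Sum.inl i => W i
  | Sum.inr i => L i

/-- The measurable space structures on the codomains of `pairFam`. -/
def pairMS {X : Type} [MeasurableSpace X] :
    (k : ℕ ⊕ ℕ) → MeasurableSpace (Sum.elim (fun _ : ℕ => ℝ) (fun _ : ℕ => X) k)
  | Sum.inl _ => (inferInstance : MeasurableSpace ℝ)
  | Sum.inr _ => (inferInstance : MeasurableSpace X)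

end MPMD


namespace MPMD

variable {X : Type*} [Fintype X] [MetricSpace X]

lemma rate_le_ballRate {lam : X → ℝ} (hlam : ∀ x, 0 < lam x) (x : X)
    {u : ℝ} (hu : 0 ≤ u) : lam x ≤ ballRate lam x u :=
  Finset.single_le_sum (f := lam) (fun _ _ => (hlam _).le) (by simpa using hu)

lemma rate_le_openBallRate {lam : X → ℝ} (hlam : ∀ x, 0 < lam x)
    (x : X) {u : ℝ} (hu : 0 < u) : lam x ≤ openBallRate lam x u :=
  Finset.single_le_sum (f := lam) (fun _ _ => (hlam _).le) (by simpa using hu)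

/-- The rate of the closed ball is a right-continuous step function of the radius. -/
lemma eventually_ballRate_eq (lam : X → ℝ) (x : X) (r : ℝ) :
    ∀ᶠ u in nhdsWithin r (Set.Ici r), ballRate lam x u = ballRate lam x r := by
  have h : ∀ᶠ u in nhdsWithin r (Set.Ici r), ∀ y, (dist x y ≤ u ↔ dist x y ≤ r) := by
    refine Filter.eventually_all.2 fun y => ?_
    rcases le_or_gt (dist x y) r with hy | hy
    · filter_upwards [self_mem_nhdsWithin] with u hu
      exact iff_of_true (hy.trans hu) hy
    · filter_upwards [nhdsWithin_le_nhds (Iio_mem_nhds hy)] with u hu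
      exact iff_of_false (not_le.2 hu) (not_le.2 hy)
  filter_upwards [h] with u hu
  simp only [ballRate, hu]

/-- Closed balls of radius slightly smaller than `r` exhaust the open ball of radius `r`. -/
lemma eventually_openBallRate_le {lam : X → ℝ}
    (hlam : ∀ x, 0 < lam x) (x : X) (r : ℝ) :
    ∀ᶠ u in nhdsWithin r (Set.Iio r), openBallRate lam x r ≤ ballRate lam x u := by
  have h : ∀ᶠ u in nhdsWithin r (Set.Iio r), ∀ y, (dist x y < r → dist x y ≤ u) := by
    refine Filter.eventually_all.2 fun y => ?_
    by_cases hy : dist x y < r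
    · filter_upwards [nhdsWithin_le_nhds (Ioi_mem_nhds hy)] with u hu _
      exact le_of_lt hu
    · exact Filter.Eventually.of_forall fun u h => absurd h hy
  filter_upwards [h] with u hu
  exact Finset.sum_le_sum_of_subset_of_nonneg
    (Finset.monotone_filter_right _ fun y _ => hu y) fun _ _ _ => (hlam _).le

lemma one_div_rate_mem {lam : X → ℝ} (hlam : ∀ x, 0 < lam x) (x : X) :
    1 / lam x ∈ {u : ℝ | 0 ≤ u ∧ 1 / ballRate lam x u ≤ u} :=
  have h := (one_div_pos.2 (hlam x)).le
  ⟨h, one_div_le_one_div_of_le (hlam x) (rate_le_ballRate hlam x h)⟩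

lemma isLeast_radius {lam : X → ℝ} (hlam : ∀ x, 0 < lam x) (x : X) :
    IsLeast {u : ℝ | 0 ≤ u ∧ 1 / ballRate lam x u ≤ u} (radius lam x) := by
  have hne : {u : ℝ | 0 ≤ u ∧ 1 / ballRate lam x u ≤ u}.Nonempty := ⟨_, one_div_rate_mem hlam x⟩
  have hglb : IsGLB {u : ℝ | 0 ≤ u ∧ 1 / ballRate lam x u ≤ u} (radius lam x) :=
    isGLB_csInf hne ⟨0, fun _ hu => hu.1⟩
  refine ⟨⟨hglb.2 fun _ hu => hu.1, ?_⟩, hglb.1⟩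
  by_contra! hlt
  obtain ⟨u, hu, heq, hult⟩ := ((hglb.frequently_mem hne).and_eventually
    ((eventually_ballRate_eq lam x _).and (nhdsWithin_le_nhds (Iio_mem_nhds hlt)))).exists
  exact absurd (heq ▸ hu.2) (not_le.2 hult)

end MPMD

open MPMD in
/-- The radius `ρ_x` is well defined: the set
`{u ≥ 0 : 1/λ(B̄(x,u)) ≤ u}` has a minimum element `ρ_x`, which satisfies
`0 < ρ_x ≤ 1/λ_x` and `1/λ(B°(x,ρ_x)) ≥ ρ_x ≥ 1/λ(B̄(x,ρ_x))`. -/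
theorem radius_isLeast_and_bounds
    {X : Type*} [Fintype X] [MetricSpace X]
    (lam : X → ℝ) (hlam : ∀ x, 0 < lam x) (x : X) :
    IsLeast {u : ℝ | 0 ≤ u ∧ 1 / ballRate lam x u ≤ u} (radius lam x) ∧
    0 < radius lam x ∧ radius lam x ≤ 1 / lam x ∧
    1 / ballRate lam x (radius lam x) ≤ radius lam x ∧
    radius lam x ≤ 1 / openBallRate lam x (radius lam x) := by
  have hleast := isLeast_radius hlam x
  have hpos : 0 < radius lam x :=
    (one_div_pos.2 ((hlam x).trans_le (rate_le_ballRate hlam x hleast.1.1))).trans_le hleast.1.2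
  refine ⟨hleast, hpos, hleast.2 (one_div_rate_mem hlam x), hleast.1.2, ?_⟩
  by_contra! hlt
  have hopen : 0 < openBallRate lam x (radius lam x) :=
    (hlam x).trans_le (rate_le_openBallRate hlam x hpos)
  obtain ⟨u, hle, hur, hu⟩ := ((eventually_openBallRate_le hlam x (radius lam x)).and
    (eventually_mem_nhdsWithin.and (nhdsWithin_le_nhds (Ioi_mem_nhds hlt)))).exists
  have hmem : 0 ≤ u ∧ 1 / ballRate lam x u ≤ u :=
    ⟨((one_div_pos.2 hopen).trans hu).le,
      (one_div_le_one_div_of_le hopen hle).trans (le_of_lt hu)⟩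
  exact absurd (hleast.2 hmem) (not_le.2 hur)
end
end

section
/- Fix α > 0 and let f(t) = t^α. For every μ > 0, if X and X' are independent exponential random variables with rates μ and 2μ respectively, then E[min{f(X'), E[f(X)]}] ≥ exp(−2 · Γ(α + 1)^{1/α}) · E[f(X)]. Consequently K_f ≤ exp(2 · Γ(α + 1)^{1/α}); since Γ(α+1)^{1/α} = O(α), this gives K_f = e^{O(α)} for f(t) = t^α. -/
open MeasureTheory ProbabilityTheory Finset
open scoped Classical ENNReal

noncomputable section

/-- The `a`-th moment of the exponential distribution of rate `r` is `Γ(a + 1) / r ^ a`. -/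
lemma expLintegral_rpow {a r : ℝ} (ha : 0 < a) (hr : 0 < r) :
    MPMD.expLintegral (fun t => t ^ a) r = ENNReal.ofReal (Real.Gamma (a + 1) / r ^ a) := by
  have hΓ : 0 < Real.Gamma (a + 1) := Real.Gamma_pos_of_pos (by linarith)
  have hra : 0 < r ^ a := Real.rpow_pos_of_pos hr a
  have hpdf (b : ℝ) : Measurable (gammaPDF b r) := (measurable_gammaPDFReal b r).ennreal_ofReal
  have hmoment (t : ℝ) : gammaPDF 1 r t * ENNReal.ofReal (t ^ a) =
      ENNReal.ofReal (Real.Gamma (a + 1) / r ^ a) * gammaPDF (a + 1) r t := by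
    rcases lt_or_ge t 0 with ht | ht
    · simp [gammaPDF_of_neg ht]
    · rw [gammaPDF_of_nonneg ht, gammaPDF_of_nonneg ht, ← ENNReal.ofReal_mul (by positivity),
        ← ENNReal.ofReal_mul (by positivity), Real.rpow_add_one hr.ne', add_sub_cancel_right]
      congr 1
      simp only [Real.rpow_one, Real.Gamma_one, sub_self, Real.rpow_zero]
      field_simp
  rw [MPMD.expLintegral, expMeasure, gammaMeasure,
    lintegral_withDensity_eq_lintegral_mul _ (hpdf 1) (by fun_prop)]
  simp only [Pi.mul_apply, hmoment]
  rw [lintegral_const_mul _ (hpdf _), lintegral_gammaPDF_eq_one (by linarith) hr, mul_one]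

/-- The tail of the exponential distribution. -/
lemma expMeasure_Ioi {r x : ℝ} (hr : 0 < r) (hx : 0 ≤ x) :
    expMeasure r (Set.Ioi x) = ENNReal.ofReal (Real.exp (-(r * x))) := by
  have := isProbabilityMeasure_expMeasure hr
  rw [← Set.compl_Iic, prob_compl_eq_one_sub measurableSet_Iic, ← ofReal_cdf,
    cdf_expMeasure_eq hr, if_pos hx, ← ENNReal.ofReal_one, ← ENNReal.ofReal_sub]
  · simp
  · simpa using mul_nonneg hr.le hx

lemma Gamma_add_one_le_rpow {b : ℝ} (hb : 0 < b) :
    Real.Gamma (b + 1) ≤ (b + 1) ^ (b + 1) := by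
  have hb1 : 0 < b + 1 := by linarith
  have hpt : ∀ t ∈ Set.Ioi (0 : ℝ), Real.exp (-t) * t ^ (b + 1 - 1) ≤
      (b + 1) ^ b * Real.exp (-(b + 1)⁻¹ * t) := by
    intro t ht
    have ht : 0 < t := ht
    have hle : t ≤ (b + 1) * Real.exp (t / (b + 1)) := by
      have := Real.add_one_le_exp (t / (b + 1))
      rw [← div_le_iff₀' hb1]
      linarith
    calc Real.exp (-t) * t ^ (b + 1 - 1)
        ≤ Real.exp (-t) * ((b + 1) * Real.exp (t / (b + 1))) ^ b := by
          rw [add_sub_cancel_right]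
          gcongr
      _ = (b + 1) ^ b * Real.exp (-(b + 1)⁻¹ * t) := by
          rw [Real.mul_rpow hb1.le (Real.exp_pos _).le, ← Real.exp_mul, mul_left_comm,
            ← Real.exp_add]
          congr 2
          field_simp
          ring
  have hint : IntegrableOn (fun t => Real.exp (-(b + 1)⁻¹ * t)) (Set.Ioi 0) :=
    integrableOn_exp_mul_Ioi (by simpa using hb1) 0
  calc Real.Gamma (b + 1)
      ≤ ∫ t in Set.Ioi (0 : ℝ), (b + 1) ^ b * Real.exp (-(b + 1)⁻¹ * t) := by
        rw [Real.Gamma_eq_integral hb1]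
        exact setIntegral_mono_on (Real.GammaIntegral_convergent hb1) (hint.const_mul _)
          measurableSet_Ioi hpt
    _ = (b + 1) ^ (b + 1) := by
        rw [integral_const_mul, integral_exp_mul_Ioi (by simpa using hb1), Real.rpow_add_one hb1.ne']
        simp

lemma Gamma_add_one_rpow_inv_le {b : ℝ} (hb : 0 < b) :
    Real.Gamma (b + 1) ^ (1 / b) ≤ Real.exp 1 * (b + 1) := by
  have hb1 : 0 < b + 1 := by linarith
  have hΓ : 0 < Real.Gamma (b + 1) := Real.Gamma_pos_of_pos hb1
  calc Real.Gamma (b + 1) ^ (1 / b)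
      ≤ ((b + 1) ^ (b + 1)) ^ (1 / b) :=
        Real.rpow_le_rpow hΓ.le (Gamma_add_one_le_rpow hb) (by positivity)
    _ = (b + 1) ^ (1 / b) * (b + 1) := by
        rw [← Real.rpow_mul hb1.le, ← Real.rpow_add_one hb1.ne']
        congr 1
        field_simp
        ring
    _ ≤ Real.exp b ^ (1 / b) * (b + 1) := by
        gcongr
        exact Real.add_one_le_exp b
    _ = Real.exp 1 * (b + 1) := by
        rw [← Real.exp_mul, mul_one_div_cancel hb.ne']

lemma ofReal_exp_mul_expLintegral_rpow_le {a r : ℝ} (ha : 0 < a) (hr : 0 < r) :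
    ENNReal.ofReal (Real.exp (-(2 * Real.Gamma (a + 1) ^ (1 / a)))) *
        MPMD.expLintegral (fun t => t ^ a) r
      ≤ ∫⁻ t, min (ENNReal.ofReal (t ^ a)) (MPMD.expLintegral (fun t => t ^ a) r)
          ∂(expMeasure (2 * r)) := by
  have hΓ : 0 < Real.Gamma (a + 1) := Real.Gamma_pos_of_pos (by linarith)
  set x := Real.Gamma (a + 1) ^ (1 / a) / r with hx_def
  have hx : 0 ≤ x := by positivity
  have hxa : x ^ a = Real.Gamma (a + 1) / r ^ a := by
    rw [hx_def, Real.div_rpow (by positivity) hr.le, ← Real.rpow_mul hΓ.le,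
      one_div_mul_cancel ha.ne', Real.rpow_one]
  have htail : expMeasure (2 * r) (Set.Ioi x) =
      ENNReal.ofReal (Real.exp (-(2 * Real.Gamma (a + 1) ^ (1 / a)))) := by
    rw [expMeasure_Ioi (by positivity) hx, hx_def]
    congr 3
    field_simp
  rw [← htail, mul_comm, ← setLIntegral_const]
  refine (setLIntegral_mono' measurableSet_Ioi fun t ht => le_min ?_ le_rfl).trans
    (setLIntegral_le_lintegral _ _)
  rw [expLintegral_rpow ha hr, ← hxa]
  exact ENNReal.ofReal_le_ofReal (Real.rpow_le_rpow hx (le_of_lt ht) ha.le)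

lemma Kf_rpow_le {a : ℝ} (ha : 0 < a) :
    MPMD.Kf (fun t => t ^ a)
      ≤ ENNReal.ofReal (Real.exp (2 * Real.Gamma (a + 1) ^ (1 / a))) := by
  refine iSup₂_le fun r hr => ENNReal.div_le_of_le_mul ?_
  calc MPMD.expLintegral (fun t => t ^ a) r
      = ENNReal.ofReal (Real.exp (2 * Real.Gamma (a + 1) ^ (1 / a))) *
          (ENNReal.ofReal (Real.exp (-(2 * Real.Gamma (a + 1) ^ (1 / a)))) *
            MPMD.expLintegral (fun t => t ^ a) r) := by
        rw [← mul_assoc, ← ENNReal.ofReal_mul (Real.exp_pos _).le, ← Real.exp_add]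
        simp
    _ ≤ _ := by
        gcongr
        exact ofReal_exp_mul_expLintegral_rpow_le ha hr

open MPMD in
/-- For `f(t) = t^α`: for every `μ > 0`, with `X ~ Exp(μ)` and
`X' ~ Exp(2μ)`, `E[min{f(X'), E[f(X)]}] ≥ exp(-2 Γ(α+1)^{1/α}) · E[f(X)]`;
consequently `K_f ≤ exp(2 Γ(α+1)^{1/α})`, and `K_f = e^{O(α)}`. -/
theorem Kf_rpow_bound (alpha : ℝ) (halpha : 0 < alpha) :
    (∀ mu : ℝ, 0 < mu →
      ENNReal.ofReal (Real.exp (-(2 * Real.Gamma (alpha + 1) ^ (1 / alpha)))) *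
          expLintegral (fun t => t ^ alpha) mu
        ≤ ∫⁻ t, min (ENNReal.ofReal (t ^ alpha)) (expLintegral (fun t => t ^ alpha) mu)
            ∂(ProbabilityTheory.expMeasure (2 * mu))) ∧
    Kf (fun t => t ^ alpha)
      ≤ ENNReal.ofReal (Real.exp (2 * Real.Gamma (alpha + 1) ^ (1 / alpha))) ∧
    ∃ C > 0, ∀ beta : ℝ, 0 < beta →
      Kf (fun t => t ^ beta) ≤ ENNReal.ofReal (Real.exp (C * (beta + 1))) := by
  refine ⟨fun mu hmu => ofReal_exp_mul_expLintegral_rpow_le halpha hmu, Kf_rpow_le halpha,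
    2 * Real.exp 1, by positivity, fun beta hbeta => (Kf_rpow_le hbeta).trans ?_⟩
  rw [mul_assoc]
  gcongr
  exact Gamma_add_one_rpow_inv_le hbeta
end
end
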